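/- arXiv:2104.02822 — 11 statements merged into one kernel-verified Lean document; each statement's English description precedes it below -/
import Mathlib

section
/- For every real number x with x ≥ -2/3, it holds that x - x² ≤ log(1 + x). -/
theorem hasDerivAt_log_one_add_sub_add_sq {x : ℝ} (hx : -1 < x) :
    HasDerivAt (fun y : ℝ => Real.log (1 + y) - y + y ^ 2) (x * (1 + 2 * x) / (1 + x)) x := by
  have h : 1 + x ≠ 0 := by linarith
  have hlog := ((hasDerivAt_id' x).const_add 1).log h
  refine ((hlog.sub (hasDerivAt_id' x)).add (hasDerivAt_pow 2 x)).congr_deriv ?_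
  push_cast
  field_simp
  ring

/-- `log (1 + x) - x + x ^ 2` is antitone on `[-1/2, 0]` and vanishes at `0`. -/
theorem sub_sq_le_log_one_add_of_nonpos {x : ℝ} (hx : -1 / 2 ≤ x) (hx0 : x ≤ 0) :
    x - x ^ 2 ≤ Real.log (1 + x) := by
  have hanti : AntitoneOn (fun y : ℝ => Real.log (1 + y) - y + y ^ 2)
      (Set.Icc (-1 / 2) 0) := by
    refine antitoneOn_of_hasDerivWithinAt_nonpos
      (f' := fun y => y * (1 + 2 * y) / (1 + y)) (convex_Icc _ _) ?_ ?_ ?_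
    · intro y hy
      exact (hasDerivAt_log_one_add_sub_add_sq
        (by linarith [hy.1])).continuousAt.continuousWithinAt
    · intro y hy
      rw [interior_Icc] at hy
      exact (hasDerivAt_log_one_add_sub_add_sq (by linarith [hy.1])).hasDerivWithinAt
    · intro y hy
      rw [interior_Icc] at hy
      exact div_nonpos_of_nonpos_of_nonneg
        (mul_nonpos_of_nonpos_of_nonneg hy.2.le (by linarith [hy.1])) (by linarith [hy.1])
  have h := hanti ⟨hx, hx0⟩ ⟨by norm_num, le_rfl⟩ hx0
  norm_num at h
  linarith

/-- On `[-2/3, -1/2]`, expand around `-2/3`, writing `1 + x = (1 + (3 * x + 2)) / 3`. -/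
theorem sub_sq_le_log_one_add_of_le_neg_half {x : ℝ} (hx : -2 / 3 ≤ x) (hx' : x ≤ -1 / 2) :
    x - x ^ 2 ≤ Real.log (1 + x) := by
  have hlog : Real.log (1 + x) = Real.log (1 + (3 * x + 2)) - Real.log 3 := by
    rw [← Real.log_div (by linarith) (by norm_num)]
    congr 1
    ring
  have hlower := Real.le_log_one_add_of_nonneg (x := 3 * x + 2) (by linarith)
  have hrat : x - x ^ 2 + 1.0986122888 ≤ 2 * (3 * x + 2) / (3 * x + 2 + 2) := by
    rw [le_div_iff₀ (by linarith)]
    nlinarith [mul_nonneg (sub_nonneg.2 hx) (sub_nonneg.2 hx'),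
      mul_nonneg (mul_nonneg (sub_nonneg.2 hx) (sub_nonneg.2 hx')) (sub_nonneg.2 hx)]
  linarith [Real.log_three_lt_d9]

theorem sub_sq_le_log_one_add_of_nonneg {x : ℝ} (hx : 0 ≤ x) :
    x - x ^ 2 ≤ Real.log (1 + x) := by
  refine le_trans ?_ (Real.le_log_one_add_of_nonneg hx)
  rw [le_div_iff₀ (by linarith)]
  nlinarith [pow_nonneg hx 2, pow_nonneg hx 3]

theorem prod_inequality_two_thirds (x : ℝ) (hx : x ≥ -2/3) :
    x - x ^ 2 ≤ Real.log (1 + x) := by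
  rcases le_total 0 x with h0 | h0
  · exact sub_sq_le_log_one_add_of_nonneg h0
  · rcases le_total (-1 / 2) x with h1 | h1
    · exact sub_sq_le_log_one_add_of_nonpos h1 h0
    · exact sub_sq_le_log_one_add_of_le_neg_half hx h1
end

section
/- Let K ≥ 2 be an integer, let (ρ_t)_{t≥1} be real numbers with −1 < ρ_t ≤ 1 for all t, and let (C_t)_{t≥0} be a nondecreasing sequence of reals with C_0 = 0 and C_t > 0 for all t ≥ 1. Define η_0 = √(log(K)/2) and, for t ≥ 1, η_t = min{ η_{t−1}, 2/(3·(1 + ρ_t)), √(log(K)/C_t) }. Then for every T ≥ 1, η_T ≥ min{ 1/3, √(log(K)/C_T) }. -/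
theorem adaprod_learning_rate_lower_bound
    (K : ℕ) (hK : 2 ≤ K)
    (ρ C η : ℕ → ℝ)
    (hρ : ∀ t, 1 ≤ t → -1 < ρ t ∧ ρ t ≤ 1)
    (hCmono : Monotone C) (hC0 : C 0 = 0) (hCpos : ∀ t, 1 ≤ t → 0 < C t)
    (hη0 : η 0 = Real.sqrt (Real.log K / 2))
    (hη : ∀ t, 1 ≤ t →
      η t = min (η (t - 1)) (min (2 / (3 * (1 + ρ t))) (Real.sqrt (Real.log K / C t)))) :
    ∀ T, 1 ≤ T → min (1/3) (Real.sqrt (Real.log K / C T)) ≤ η T := by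
  have hlog : Real.log 2 ≤ Real.log K :=
    Real.log_le_log (by norm_num) (by exact_mod_cast hK)
  have hlog2 := Real.log_two_gt_d9
  have hinit : 1 / 3 ≤ η 0 := by
    rw [hη0]
    apply Real.le_sqrt_of_sq_le
    linarith
  have hpred : ∀ t, 1 ≤ t → 1 / 3 ≤ 2 / (3 * (1 + ρ t)) := by
    intro t ht
    obtain ⟨h₁, h₂⟩ := hρ t ht
    rw [div_le_div_iff₀ (by norm_num) (by linarith)]
    linarith
  intro T hT
  induction T, hT using Nat.le_induction with
  | base =>
    rw [hη 1 le_rfl]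
    exact le_min ((min_le_left _ _).trans hinit)
      (min_le_min_right _ (hpred 1 le_rfl))
  | succ t ht ih =>
    have hsqrt : Real.sqrt (Real.log K / C (t + 1)) ≤ Real.sqrt (Real.log K / C t) :=
      Real.sqrt_le_sqrt (div_le_div_of_nonneg_left (by linarith) (hCpos t ht)
        (hCmono t.le_succ))
    rw [hη (t + 1) (by omega), Nat.add_sub_cancel]
    exact le_min ((min_le_min_left _ hsqrt).trans ih)
      (min_le_min_right _ (hpred (t + 1) (by omega)))
end

section
/- Let K ≥ 1 be an integer and for each i ∈ {1,…,K} let w_i > 0, η_i > 0, ŕ_i ∈ (−1, 1], and ℓ_i ∈ [0,1] be reals with η_i ≤ 2/(3·(1 + ŕ_i)), and let η'_i be reals with 0 < η'_i ≤ η_i. Define Z = Σ_{j=1}^{K} η_j·w_j·exp(η_j·ŕ_j), p_i = η_i·w_i·exp(η_i·ŕ_i)/Z, r_i = Σ_{j=1}^{K} p_j·ℓ_j − ℓ_i, and w'_i = ( w_i·exp( η_i·r_i − η_i²·(r_i − ŕ_i)² ) )^{η'_i/η_i}. Then Σ_{i=1}^{K} w'_i ≤ Σ_{i=1}^{K} w_i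 + Σ_{i=1}^{K} log(η_i/η'_i). -/
theorem Real.exp_sub_sq_le_one_add {u : ℝ} (hu : -(2 / 3) ≤ u) :
    Real.exp (u - u ^ 2) ≤ 1 + u := by
  have hpos : 0 < 1 + u := by linarith
  suffices h : 1 ≤ (1 + u) * Real.exp (u ^ 2 - u) by
    rw [← neg_sub, Real.exp_neg]
    exact inv_le_of_inv_le₀ hpos (by rwa [inv_le_iff_one_le_mul₀' hpos])
  rcases le_total 0 u with h0 | h0
  · have h1 : 1 ≤ (1 + u) * (u ^ 2 - u + 1) := by
      have := pow_nonneg h0 3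
      linarith
    exact h1.trans (mul_le_mul_of_nonneg_left (Real.add_one_le_exp _) hpos.le)
  · obtain ⟨v, rfl⟩ : ∃ v, u = -v := ⟨-u, by ring⟩
    have hv0 : 0 ≤ v := by linarith
    have hv : v ≤ 2 / 3 := by linarith
    have htaylor := Real.sum_le_exp_of_nonneg (x := (-v) ^ 2 - -v) (by nlinarith) 5
    refine le_trans ?_ (mul_le_mul_of_nonneg_left htaylor hpos.le)
    have hpow (k : ℕ) : v ^ k ≤ (2 / 3) ^ k := pow_le_pow_left₀ hv0 hv k
    have hQ : 0 ≤ 1 / 2 - v / 3 - v ^ 2 / 8 - 3 * v ^ 3 / 8 - v ^ 4 / 4 - v ^ 5 / 4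
        - v ^ 6 / 8 - v ^ 7 / 24 := by
      linarith [hpow 2, hpow 3, hpow 4, hpow 5, hpow 6, hpow 7]
    have := mul_nonneg (sq_nonneg v) hQ
    simp only [Finset.sum_range_succ, Finset.sum_range_zero, Nat.factorial]
    push_cast
    linarith

theorem Real.exp_mul_one_sub_le_one (x : ℝ) : Real.exp x * (1 - x) ≤ 1 := by
  calc Real.exp x * (1 - x) ≤ Real.exp x * Real.exp (-x) :=
        mul_le_mul_of_nonneg_left (Real.one_sub_le_exp_neg x) (Real.exp_pos x).le
    _ = 1 := by rw [← Real.exp_add, add_neg_cancel, Real.exp_zero]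

theorem Real.rpow_le_add_log_inv {x a : ℝ} (hx : 0 ≤ x) (ha : 0 < a) (ha1 : a ≤ 1) :
    x ^ a ≤ x + Real.log a⁻¹ := by
  have h1 : x ^ a ≤ a * x + (1 - a) := by
    have := Real.geom_mean_le_arith_mean2_weighted ha.le (sub_nonneg.2 ha1) hx zero_le_one
      (by ring)
    simpa using this
  have h2 := Real.one_sub_inv_le_log_of_pos (inv_pos.2 ha)
  rw [inv_inv] at h2
  have := mul_le_of_le_one_left hx ha1
  linarith

theorem adaprod_one_round_potential_bound
    (K : ℕ) (hK : 1 ≤ K)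
    (w η rhat ℓ η' : Fin K → ℝ)
    (hw : ∀ i, 0 < w i) (hη : ∀ i, 0 < η i)
    (hrhat : ∀ i, -1 < rhat i ∧ rhat i ≤ 1)
    (hℓ : ∀ i, 0 ≤ ℓ i ∧ ℓ i ≤ 1)
    (hηub : ∀ i, η i ≤ 2 / (3 * (1 + rhat i)))
    (hη' : ∀ i, 0 < η' i) (hη'le : ∀ i, η' i ≤ η i)
    (Z : ℝ) (hZ : Z = ∑ j, η j * w j * Real.exp (η j * rhat j))
    (p : Fin K → ℝ) (hp : ∀ i, p i = η i * w i * Real.exp (η i * rhat i) / Z)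
    (r : Fin K → ℝ) (hr : ∀ i, r i = (∑ j, p j * ℓ j) - ℓ i)
    (w' : Fin K → ℝ)
    (hw' : ∀ i, w' i =
      (w i * Real.exp (η i * r i - (η i) ^ 2 * (r i - rhat i) ^ 2)) ^ (η' i / η i)) :
    ∑ i, w' i ≤ (∑ i, w i) + ∑ i, Real.log (η i / η' i) := by
  have : NeZero K := ⟨by omega⟩
  have hq (i : Fin K) : 0 < η i * w i * Real.exp (η i * rhat i) :=
    mul_pos (mul_pos (hη i) (hw i)) (Real.exp_pos _)
  have hZpos : 0 < Z := hZ ▸ Finset.sum_pos (fun i _ => hq i) Finset.univ_nonempty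
  have hr_ge (i : Fin K) : -1 ≤ r i := by
    have : 0 ≤ ∑ j, p j * ℓ j := Finset.sum_nonneg fun j _ =>
      mul_nonneg (hp j ▸ (div_pos (hq j) hZpos).le) (hℓ j).1
    rw [hr]
    linarith [(hℓ i).2]
  have hregret : ∑ i, η i * w i * Real.exp (η i * rhat i) * r i = 0 := by
    have hmean : Z * ∑ j, p j * ℓ j = ∑ j, η j * w j * Real.exp (η j * rhat j) * ℓ j := by
      rw [Finset.mul_sum]
      refine Finset.sum_congr rfl fun j _ => ?_
      rw [hp, ← mul_assoc, mul_div_cancel₀ _ hZpos.ne']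
    simp only [hr, mul_sub, Finset.sum_sub_distrib]
    rw [← Finset.sum_mul, ← hZ, hmean, sub_self]
  have hweight (i : Fin K) :
      w i * Real.exp (η i * r i - (η i) ^ 2 * (r i - rhat i) ^ 2) ≤
        w i + η i * w i * Real.exp (η i * rhat i) * r i := by
    have hu : -(2 / 3) ≤ η i * (r i - rhat i) := by
      have h1 : 0 < 1 + rhat i := by linarith [(hrhat i).1]
      have h2 := hηub i
      rw [le_div_iff₀ (by positivity)] at h2
      nlinarith [mul_le_mul_of_nonneg_left (hr_ge i) (hη i).le]
    have hexp : Real.exp (η i * r i - (η i) ^ 2 * (r i - rhat i) ^ 2) ≤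
        Real.exp (η i * rhat i) * (1 + η i * (r i - rhat i)) := by
      have hsplit : η i * r i - (η i) ^ 2 * (r i - rhat i) ^ 2 =
          η i * rhat i + (η i * (r i - rhat i) - (η i * (r i - rhat i)) ^ 2) := by ring
      rw [hsplit, Real.exp_add]
      exact mul_le_mul_of_nonneg_left (Real.exp_sub_sq_le_one_add hu) (Real.exp_pos _).le
    have h1 := mul_le_mul_of_nonneg_left hexp (hw i).le
    have h2 := mul_le_mul_of_nonneg_left (Real.exp_mul_one_sub_le_one (η i * rhat i)) (hw i).le
    linarith
  have hpotential : ∑ i, w i * Real.exp (η i * r i - (η i) ^ 2 * (r i - rhat i) ^ 2) ≤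
      ∑ i, w i := by
    have := Finset.sum_le_sum fun i (_ : i ∈ Finset.univ) => hweight i
    rwa [Finset.sum_add_distrib, hregret, add_zero] at this
  have hrate (i : Fin K) :
      w' i ≤ w i * Real.exp (η i * r i - (η i) ^ 2 * (r i - rhat i) ^ 2) +
        Real.log (η i / η' i) := by
    rw [hw', ← inv_div (η' i) (η i)]
    exact Real.rpow_le_add_log_inv (mul_pos (hw i) (Real.exp_pos _)).le
      (div_pos (hη' i) (hη i)) ((div_le_one (hη i)).2 (hη'le i))
  have := Finset.sum_le_sum fun i (_ : i ∈ Finset.univ) => hrate i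
  rw [Finset.sum_add_distrib] at this
  linarith
end

section
/- Let K ≥ 1 be an integer and for each i ∈ {1,…,K} let w_i ≥ 0 and η_i > 0 be reals, and let ŕ_i and r_i be arbitrary reals. If Σ_{i=1}^{K} η_i·w_i·ŕ_i·exp(η_i·ŕ_i) = 0, then Σ_{i=1}^{K} w_i·exp( η_i·r_i − η_i²·(r_i − ŕ_i)² ) ≤ e^{1/4} · Σ_{i=1}^{K} w_i. -/
/-- Combines `x - x ^ 2 ≤ 1 / 4` at `x = a - b` with `1 - b ≤ exp (-b)`. -/
lemma Real.exp_sub_sub_sq_le (a b : ℝ) :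
    Real.exp (a - (a - b) ^ 2) ≤ Real.exp (1 / 4) * (1 + b * Real.exp b) := by
  have h₁ : Real.exp (a - (a - b) ^ 2) ≤ Real.exp (1 / 4) * Real.exp b := by
    rw [← Real.exp_add, Real.exp_le_exp]
    nlinarith [sq_nonneg (a - b - 1 / 2)]
  have h₂ : Real.exp b ≤ 1 + b * Real.exp b := by
    have h := mul_le_mul_of_nonneg_right (Real.one_sub_le_exp_neg b) (Real.exp_pos b).le
    rw [← Real.exp_add, neg_add_cancel, Real.exp_zero] at h
    linarith
  exact h₁.trans (mul_le_mul_of_nonneg_left h₂ (Real.exp_pos _).le)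

theorem adaprod_first_round_potential_bound
    (K : ℕ) (hK : 1 ≤ K)
    (w η rhat r : Fin K → ℝ)
    (hw : ∀ i, 0 ≤ w i) (hη : ∀ i, 0 < η i)
    (hzero : ∑ i, η i * w i * rhat i * Real.exp (η i * rhat i) = 0) :
    ∑ i, w i * Real.exp (η i * r i - (η i) ^ 2 * (r i - rhat i) ^ 2) ≤
      Real.exp (1/4) * ∑ i, w i := by
  calc ∑ i, w i * Real.exp (η i * r i - (η i) ^ 2 * (r i - rhat i) ^ 2)
      ≤ ∑ i, Real.exp (1 / 4) *
          (w i + η i * w i * rhat i * Real.exp (η i * rhat i)) := by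
        refine Finset.sum_le_sum fun i _ => ?_
        have h := mul_le_mul_of_nonneg_left
          (Real.exp_sub_sub_sq_le (η i * r i) (η i * rhat i)) (hw i)
        rw [← mul_sub, mul_pow] at h
        exact h.trans_eq (by ring)
    _ = Real.exp (1 / 4) * ∑ i, w i := by
        rw [← Finset.mul_sum, Finset.sum_add_distrib, hzero, add_zero]
end

section
/- Let n ≥ 1 and let a ≤ b be integers, and let x_t ∈ ℝ^n for every integer t ∈ {a,…,b}. Define the drift D = Σ_{t=a+1}^{b} max_{i∈{1,…,n}} |x_t(i) − x_{t−1}(i)|, and suppose i* ∈ {1,…,n} satisfies Σ_{t=a}^{b} x_t(i*) ≥ Σ_{t=a}^{b} x_t(j) for every j ∈ {1,…,n}. Then for every t ∈ {a,…,b} and every j ∈ {1,…,n}: x_t(j) ≤ x_t(i*) + 2·D. -/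
theorem abs_sub_le_sum_Icc_abs_sub_pred (f : ℤ → ℝ) {s t : ℤ} (hst : s ≤ t) :
    |f t - f s| ≤ ∑ r ∈ Finset.Icc (s + 1) t, |f r - f (r - 1)| := by
  induction t, hst using Int.leInduction with
  | base => simp
  | succ t hst ih =>
    have hIcc : Finset.Icc (s + 1) (t + 1) = insert (t + 1) (Finset.Icc (s + 1) t) := by
      ext r
      simp only [Finset.mem_insert, Finset.mem_Icc]
      omega
    rw [hIcc, Finset.sum_insert (by simp), add_sub_cancel_right]
    linarith [abs_sub_le (f (t + 1)) (f t) (f s)]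

theorem abs_sub_le_sum_Icc_of_abs_sub_pred_le {f g : ℤ → ℝ} {a b s t : ℤ}
    (hfg : ∀ r ∈ Finset.Icc (a + 1) b, |f r - f (r - 1)| ≤ g r)
    (hs : s ∈ Finset.Icc a b) (ht : t ∈ Finset.Icc a b) :
    |f t - f s| ≤ ∑ r ∈ Finset.Icc (a + 1) b, g r := by
  wlog hst : s ≤ t generalizing s t
  · rw [abs_sub_comm]
    exact this ht hs (le_of_not_ge hst)
  rw [Finset.mem_Icc] at hs ht
  calc |f t - f s| ≤ ∑ r ∈ Finset.Icc (s + 1) t, |f r - f (r - 1)| :=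
        abs_sub_le_sum_Icc_abs_sub_pred f hst
    _ ≤ ∑ r ∈ Finset.Icc (a + 1) b, |f r - f (r - 1)| :=
        Finset.sum_le_sum_of_subset_of_nonneg
          (Finset.Icc_subset_Icc (by linarith) ht.2) fun _ _ _ => abs_nonneg _
    _ ≤ ∑ r ∈ Finset.Icc (a + 1) b, g r := Finset.sum_le_sum hfg

theorem block_optimal_expert_drift_bound
    (n : ℕ) (hn : 1 ≤ n)
    (a b : ℤ) (hab : a ≤ b)
    (x : ℤ → Fin n → ℝ)
    (D : ℝ)
    (hD : D = ∑ t ∈ Finset.Icc (a + 1) b,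
      Finset.univ.sup' (Finset.univ_nonempty_iff.mpr ⟨⟨0, hn⟩⟩)
        (fun i => |x t i - x (t - 1) i|))
    (istar : Fin n)
    (hopt : ∀ j : Fin n, ∑ t ∈ Finset.Icc a b, x t j ≤ ∑ t ∈ Finset.Icc a b, x t istar) :
    ∀ t ∈ Finset.Icc a b, ∀ j : Fin n, x t j ≤ x t istar + 2 * D := by
  intro t ht j
  obtain ⟨s, hs, hsj⟩ := Finset.exists_le_of_sum_le (Finset.nonempty_Icc.mpr hab) (hopt j)
  have drift (i : Fin n) : |x t i - x s i| ≤ D := by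
    rw [hD]
    exact abs_sub_le_sum_Icc_of_abs_sub_pred_le (f := fun r => x r i)
      (fun r _ => Finset.le_sup' (fun i => |x r i - x (r - 1) i|) (Finset.mem_univ i)) hs ht
  linarith [(abs_le.mp (drift j)).2, (abs_le.mp (drift istar)).1]
end

section
/- Let n ≥ 1, T ≥ 1, and B ≥ 1 be integers and let x_t ∈ ℝ^n for t ∈ {1,…,T}. Suppose {1,…,T} is partitioned into N contiguous blocks 𝒯_1,…,𝒯_N (each block an integer interval, ordered consecutively), each of cardinality at most B. Define the drift D = Σ_{t=2}^{T} max_{i∈{1,…,n}} |x_t(i) − x_{t−1}(i)|, and for each block 𝒯_b let i_b ∈ {1,…,n} satisfy Σ_{t∈𝒯_b} x_t(i_b) ≥ Σ_{t∈𝒯_b} x_t(j) for every j. Then for every sequence (j_t)_{t∈{1,…,T}} with j_t ∈ {1,…,n}: Σ_{b=1}^{N} Σ_{t∈𝒯_b} ( x_t(j_t) − x_t(i_b) ) ≤ 2·B·D. -/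
/-- A function whose successive differences are bounded by those of a monotone `F` has, on
`{a + 1, …, c}`, oscillation at most `F c - F a`. -/
theorem abs_sub_le_of_abs_succ_sub_le {f F : ℕ → ℝ} (hF : Monotone F)
    (h : ∀ m, 1 ≤ m → |f (m + 1) - f m| ≤ F (m + 1) - F m) {a c s t : ℕ}
    (hs : s ∈ Finset.Icc (a + 1) c) (ht : t ∈ Finset.Icc (a + 1) c) :
    |f s - f t| ≤ F c - F a := by
  have key : ∀ u v, 1 ≤ u → u ≤ v → |f v - f u| ≤ F v - F u := by
    intro u v hu huv
    induction v, huv using Nat.le_induction with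
    | base => simp
    | succ m hm ih =>
      have h₁ := abs_sub_le (f (m + 1)) (f m) (f u)
      have h₂ := h m (hu.trans hm)
      linarith
  rw [Finset.mem_Icc] at hs ht
  have hsc := hF hs.2
  have htc := hF ht.2
  have has := hF (show a ≤ s by omega)
  have hat := hF (show a ≤ t by omega)
  rcases le_total s t with hst | hst
  · rw [abs_sub_comm]
    linarith [key s t (by omega) hst]
  · linarith [key t s (by omega) hst]

/-- On a finite set where every coordinate oscillates by at most `δ`, a comparator sequence gains
at most `2 δ` per step over the best fixed coordinate. -/
theorem sum_sub_le_card_mul_of_oscillation_le {ι κ : Type*} (S : Finset ι) (x : ι → κ → ℝ) {δ : ℝ}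
    (hosc : ∀ k, ∀ s ∈ S, ∀ t ∈ S, |x s k - x t k| ≤ δ) (i : κ)
    (hopt : ∀ k, ∑ t ∈ S, x t k ≤ ∑ t ∈ S, x t i) (j : ι → κ) :
    ∑ t ∈ S, (x t (j t) - x t i) ≤ S.card * (2 * δ) := by
  rw [← nsmul_eq_mul]
  refine Finset.sum_le_card_nsmul _ _ _ fun t ht => ?_
  obtain ⟨s, hs, hle⟩ := Finset.exists_le_of_sum_le ⟨t, ht⟩ (hopt (j t))
  have h₁ := (abs_le.mp (hosc (j t) t ht s hs)).2
  have h₂ := (abs_le.mp (hosc i s hs t ht)).2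
  linarith

theorem block_decomposition_drift_bound
    (n T B N : ℕ) (hn : 1 ≤ n) (hT : 1 ≤ T) (hB : 1 ≤ B)
    (x : ℕ → Fin n → ℝ)
    (e : ℕ → ℕ) (he0 : e 0 = 0) (heN : e N = T)
    (hmono : ∀ b < N, e b ≤ e (b + 1))
    (hcard : ∀ b < N, e (b + 1) - e b ≤ B)
    (D : ℝ)
    (hD : D = ∑ t ∈ Finset.Icc 2 T,
      Finset.univ.sup' (Finset.univ_nonempty_iff.mpr ⟨⟨0, hn⟩⟩)
        (fun i => |x t i - x (t - 1) i|))
    (i : ℕ → Fin n)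
    (hopt : ∀ b < N, ∀ j : Fin n,
      ∑ t ∈ Finset.Icc (e b + 1) (e (b + 1)), x t j ≤
        ∑ t ∈ Finset.Icc (e b + 1) (e (b + 1)), x t (i b))
    (j : ℕ → Fin n) :
    ∑ b ∈ Finset.range N, ∑ t ∈ Finset.Icc (e b + 1) (e (b + 1)),
      (x t (j t) - x t (i b)) ≤ 2 * B * D := by
  have hne : (Finset.univ : Finset (Fin n)).Nonempty :=
    Finset.univ_nonempty_iff.mpr ⟨⟨0, hn⟩⟩
  set d : ℕ → ℝ := fun t => Finset.univ.sup' hne (fun i => |x t i - x (t - 1) i|)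
  set F : ℕ → ℝ := fun m => ∑ t ∈ Finset.Icc 2 m, d t with hFdef
  have hle : ∀ t k, |x t k - x (t - 1) k| ≤ d t := fun t k =>
    Finset.le_sup' (fun i => |x t i - x (t - 1) i|) (Finset.mem_univ k)
  have hd0 : ∀ t, 0 ≤ d t := fun t => (abs_nonneg _).trans (hle t ⟨0, hn⟩)
  have hF : Monotone F := fun a c hac =>
    Finset.sum_le_sum_of_subset_of_nonneg (Finset.Icc_subset_Icc_right hac) fun t _ _ => hd0 t
  have hstep : ∀ k m, 1 ≤ m → |x (m + 1) k - x m k| ≤ F (m + 1) - F m := by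
    intro k m hm
    have hsucc : F (m + 1) = F m + d (m + 1) := Finset.sum_Icc_succ_top (by omega) d
    rw [hsucc, add_sub_cancel_left]
    exact hle (m + 1) k
  have hblock : ∀ b ∈ Finset.range N,
      ∑ t ∈ Finset.Icc (e b + 1) (e (b + 1)), (x t (j t) - x t (i b)) ≤
        2 * B * (F (e (b + 1)) - F (e b)) := by
    intro b hb
    rw [Finset.mem_range] at hb
    have hδ : 0 ≤ F (e (b + 1)) - F (e b) := sub_nonneg.mpr (hF (hmono b hb))
    have hB' : ((Finset.Icc (e b + 1) (e (b + 1))).card : ℝ) ≤ B := by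
      rw [Nat.card_Icc, Nat.add_sub_add_right]
      exact_mod_cast hcard b hb
    calc _ ≤ _ := sum_sub_le_card_mul_of_oscillation_le _ x
          (fun k s hs t ht => abs_sub_le_of_abs_succ_sub_le (f := fun m => x m k) hF (hstep k) hs ht)
          (i b) (hopt b hb) j
      _ ≤ B * (2 * (F (e (b + 1)) - F (e b))) := by gcongr
      _ = _ := by ring
  refine (Finset.sum_le_sum hblock).trans_eq ?_
  rw [← Finset.mul_sum, Finset.sum_range_sub (fun b => F (e b)), he0, heN, hD]
  simp [hFdef]
end

section
/- Let K ≥ 2 and T ≥ 1 be integers, let c_1,…,c_T be reals with 0 ≤ c_t ≤ 4 for every t, and set C_t = Σ_{s=1}^{t} c_s (so C_0 = 0). Let η_0, η_1, …, η_{T−1} be positive reals such that η_t ≤ √(log(K)/2) for every t, and η_t ≤ √(log(K)/C_t) for every t ≥ 1 with C_t > 0. Then Σ_{t=1}^{T} η_{t−1}·c_t ≤ 4√2 · √( C_T · log K ). -/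
/-- One step of the telescoping bound: `h * c` is controlled by the increment of the square root. -/
lemma mul_le_sqrt_sub_sqrt {P c h L : ℝ} (hP : 0 ≤ P) (hc0 : 0 ≤ c) (hc4 : c ≤ 4) (hh : 0 ≤ h)
    (h1 : h ≤ √(L / 2)) (h2 : 0 < P → h ≤ √(L / P)) :
    h * c ≤ 4 * √2 * √L * (√(P + c) - √P) := by
  have hs : √2 * √2 = 2 := Real.mul_self_sqrt (by norm_num)
  have hs1 : 1 ≤ √2 := Real.one_le_sqrt.2 (by norm_num)
  have ha : √P * √P = P := Real.mul_self_sqrt hP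
  have hb : √(P + c) * √(P + c) = P + c := Real.mul_self_sqrt (by positivity)
  have ha0 := Real.sqrt_nonneg P
  have hl0 := Real.sqrt_nonneg L
  have hab : √P ≤ √(P + c) := Real.sqrt_le_sqrt (by linarith)
  have hba : √(P + c) ≤ √P + 2 := Real.sqrt_le_iff.2 ⟨by linarith, by nlinarith⟩
  have hhs : h * √2 ≤ √L := by
    rwa [Real.sqrt_div' _ (by norm_num), le_div_iff₀ (by positivity)] at h1
  have hha : h * √P ≤ √L := by
    rcases hP.eq_or_lt with rfl | hP'
    · simp
    · have := h2 hP'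
      rwa [Real.sqrt_div' _ hP, le_div_iff₀ (Real.sqrt_pos.2 hP')] at this
  have hsum : h * (√(P + c) + √P) ≤ 4 * √2 * √L := by
    have e1 : h * √(P + c) ≤ h * (√P + 2) := mul_le_mul_of_nonneg_left hba hh
    have e2 : h ≤ h * √2 := le_mul_of_one_le_right hh hs1
    have e3 : √L ≤ √2 * √L := le_mul_of_one_le_left hl0 hs1
    linarith
  calc h * c = h * (√(P + c) + √P) * (√(P + c) - √P) := by linear_combination h * ha - h * hb
    _ ≤ _ := mul_le_mul_of_nonneg_right hsum (by linarith)


theorem weighted_prediction_error_bound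
    (K T : ℕ) (hK : 2 ≤ K) (hT : 1 ≤ T)
    (c : ℕ → ℝ) (hc : ∀ t, 1 ≤ t → t ≤ T → 0 ≤ c t ∧ c t ≤ 4)
    (C : ℕ → ℝ) (hC : ∀ t, C t = ∑ s ∈ Finset.Icc 1 t, c s)
    (η : ℕ → ℝ) (hηpos : ∀ t, 0 < η t)
    (hη1 : ∀ t, η t ≤ Real.sqrt (Real.log K / 2))
    (hη2 : ∀ t, 1 ≤ t → 0 < C t → η t ≤ Real.sqrt (Real.log K / C t)) :
    ∑ t ∈ Finset.Icc 1 T, η (t - 1) * c t ≤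
      4 * Real.sqrt 2 * Real.sqrt (C T * Real.log K) := by
  have hstep : ∀ t, C (t + 1) = C t + c (t + 1) := fun t => by
    rw [hC, hC, Finset.sum_Icc_succ_top (by omega)]
  have hC0 : C 0 = 0 := by simp [hC]
  have hCnonneg : ∀ t ≤ T, 0 ≤ C t := fun t ht => by
    rw [hC]
    exact Finset.sum_nonneg fun s hs =>
      (hc s (Finset.mem_Icc.1 hs).1 ((Finset.mem_Icc.1 hs).2.trans ht)).1
  have key : ∀ n ≤ T, ∑ t ∈ Finset.Icc 1 n, η (t - 1) * c t ≤
      4 * √2 * √(Real.log K) * √(C n) := by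
    intro n
    induction n with
    | zero => simp [hC0]
    | succ n ih =>
      intro hn
      have hcn := hc (n + 1) (by omega) hn
      have hinc := mul_le_sqrt_sub_sqrt (hCnonneg n (by omega)) hcn.1 hcn.2 (hηpos n).le (hη1 n)
        fun hpos => hη2 n (Nat.one_le_iff_ne_zero.2 fun h0 => by simp [h0, hC0] at hpos) hpos
      rw [Finset.sum_Icc_succ_top (by omega), Nat.add_sub_cancel, hstep]
      linarith [ih (by omega)]
  calc _ ≤ _ := key T le_rfl
    _ = _ := by rw [Real.sqrt_mul (hCnonneg T le_rfl)]; ring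
end

section
/- Let K ≥ 1 be an integer and for each i ∈ {1,…,K} let w_i > 0, η_i > 0, and ℓ̂_i ∈ [0,1] be reals. For α ∈ [0,1] define q_i(α) = η_i·w_i·exp(η_i·(α − ℓ̂_i)) / Σ_{j=1}^{K} η_j·w_j·exp(η_j·(α − ℓ̂_j)). Then there exists α ∈ [0,1] such that α = Σ_{i=1}^{K} q_i(α)·ℓ̂_i. -/
theorem adaprod_optimistic_fixed_point
    (K : ℕ) (hK : 1 ≤ K)
    (w η ℓhat : Fin K → ℝ)
    (hw : ∀ i, 0 < w i) (hη : ∀ i, 0 < η i)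
    (hℓhat : ∀ i, 0 ≤ ℓhat i ∧ ℓhat i ≤ 1)
    (q : ℝ → Fin K → ℝ)
    (hq : ∀ α ∈ Set.Icc (0 : ℝ) 1, ∀ i,
      q α i = η i * w i * Real.exp (η i * (α - ℓhat i)) /
        ∑ j, η j * w j * Real.exp (η j * (α - ℓhat j))) :
    ∃ α ∈ Set.Icc (0 : ℝ) 1, α = ∑ i, q α i * ℓhat i := by
  have : Nonempty (Fin K) := ⟨⟨0, hK⟩⟩
  have hpos : ∀ α i, 0 < η i * w i * Real.exp (η i * (α - ℓhat i)) := fun α i =>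
    mul_pos (mul_pos (hη i) (hw i)) (Real.exp_pos _)
  have hsum : ∀ α, 0 < ∑ j, η j * w j * Real.exp (η j * (α - ℓhat j)) := fun α =>
    Finset.sum_pos (fun j _ => hpos α j) Finset.univ_nonempty
  have hq_nonneg : ∀ α ∈ Set.Icc (0 : ℝ) 1, ∀ i, 0 ≤ q α i := fun α hα i => by
    rw [hq α hα i]
    exact (div_pos (hpos α i) (hsum α)).le
  have hq_sum : ∀ α ∈ Set.Icc (0 : ℝ) 1, ∑ i, q α i = 1 := fun α hα => by
    rw [Finset.sum_congr rfl fun i _ => hq α hα i, ← Finset.sum_div, div_self (hsum α).ne']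
  have hcont : ContinuousOn (fun α => ∑ i, q α i * ℓhat i) (Set.Icc 0 1) := by
    refine continuousOn_finsetSum _ fun i _ => ContinuousOn.mul ?_ continuousOn_const
    refine ContinuousOn.congr (Continuous.continuousOn ?_) fun α hα => hq α hα i
    exact Continuous.div (by fun_prop) (by fun_prop) fun α => (hsum α).ne'
  have hmaps : Set.MapsTo (fun α => ∑ i, q α i * ℓhat i) (Set.Icc 0 1) (Set.Icc 0 1) := by
    intro α hα
    refine ⟨Finset.sum_nonneg fun i _ => mul_nonneg (hq_nonneg α hα i) (hℓhat i).1, ?_⟩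
    rw [← hq_sum α hα]
    exact Finset.sum_le_sum fun i _ => mul_le_of_le_one_right (hq_nonneg α hα i) (hℓhat i).2
  obtain ⟨α, hα, hfix⟩ := exists_mem_Icc_isFixedPt_of_mapsTo hcont zero_le_one hmaps
  exact ⟨α, hα, hfix.symm⟩
end

section
/- Under the base AdaProd⁺ recursion, the total potential satisfies Σ_{i=1}^{K} w_{T,i} ≤ K·e^{1/4} + Σ_{i=1}^{K} log( η_{0,i} / η_{T,i} ). -/
/-- The second-order inequality `x - x ^ 2 ≤ log (1 + x)` on `[-2/3, ∞)`. -/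
theorem sub_sq_le_log_one_add {x : ℝ} (hx : -(2 / 3) ≤ x) : x - x ^ 2 ≤ Real.log (1 + x) := by
  let f : ℝ → ℝ := fun y => Real.log (1 + y) - y + y ^ 2
  have hder : ∀ y : ℝ, -(2 / 3) ≤ y → HasDerivAt f (y * (2 * y + 1) / (1 + y)) y := by
    intro y hy
    have hpos : (0 : ℝ) < 1 + y := by linarith
    have h : HasDerivAt f (1 / (1 + y) - 1 + 2 * y ^ 1) y :=
      ((((hasDerivAt_id' y).const_add 1).log hpos.ne').sub (hasDerivAt_id' y)).add
        (hasDerivAt_pow 2 y)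
    refine h.congr_deriv ?_
    field_simp
    ring
  have hcont : ∀ s : Set ℝ, (∀ y ∈ s, -(2 / 3) ≤ y) → ContinuousOn f s := fun s hs y hy =>
    (hder y (hs y hy)).continuousAt.continuousWithinAt
  have hf0 : f 0 = 0 := by simp [f]
  suffices h : 0 ≤ f x by
    simp only [f] at h
    linarith
  rcases le_total 0 x with h0 | h0
  · have hmono : MonotoneOn f (Set.Ici 0) := by
      refine monotoneOn_of_hasDerivWithinAt_nonneg (convex_Ici 0)
        (f' := fun y => y * (2 * y + 1) / (1 + y)) (hcont _ fun y hy => ?_)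
        (fun y hy => (hder y ?_).hasDerivWithinAt) fun y hy => ?_
      · linarith [Set.mem_Ici.1 hy]
      · rw [interior_Ici] at hy
        linarith [Set.mem_Ioi.1 hy]
      · rw [interior_Ici] at hy
        have := Set.mem_Ioi.1 hy
        positivity
    simpa [hf0] using hmono Set.self_mem_Ici h0 h0
  rcases le_total (-(1 / 2)) x with h1 | h1
  · have hanti : AntitoneOn f (Set.Icc (-(1 / 2)) 0) := by
      refine antitoneOn_of_hasDerivWithinAt_nonpos (convex_Icc _ _)
        (f' := fun y => y * (2 * y + 1) / (1 + y)) (hcont _ fun y hy => ?_)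
        (fun y hy => (hder y ?_).hasDerivWithinAt) fun y hy => ?_
      · linarith [hy.1]
      · rw [interior_Icc] at hy
        linarith [hy.1]
      · rw [interior_Icc] at hy
        exact div_nonpos_of_nonpos_of_nonneg
          (mul_nonpos_of_nonpos_of_nonneg hy.2.le (by linarith [hy.1])) (by linarith [hy.1])
    simpa [hf0] using hanti ⟨h1, h0⟩ ⟨by norm_num, le_rfl⟩ h0
  · have hmono : MonotoneOn f (Set.Icc (-(2 / 3)) (-(1 / 2))) := by
      refine monotoneOn_of_hasDerivWithinAt_nonneg (convex_Icc _ _)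
        (f' := fun y => y * (2 * y + 1) / (1 + y)) (hcont _ fun y hy => hy.1)
        (fun y hy => (hder y ?_).hasDerivWithinAt) fun y hy => ?_
      · rw [interior_Icc] at hy
        exact hy.1.le
      · rw [interior_Icc] at hy
        exact div_nonneg (mul_nonneg_of_nonpos_of_nonpos (by linarith [hy.2])
          (by linarith [hy.2])) (by linarith [hy.1])
    have hend : 0 ≤ f (-(2 / 3)) := by
      have h3 : Real.log 3 ≤ 10 / 9 := by
        rw [Real.log_le_iff_le_exp (by norm_num), show (10 / 9 : ℝ) = 1 + 1 / 9 by norm_num,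
          Real.exp_add]
        nlinarith [Real.exp_one_gt_d9, Real.add_one_le_exp (1 / 9 : ℝ)]
      have hlog : Real.log (1 + -(2 / 3)) = -Real.log 3 := by
        rw [← Real.log_inv]
        norm_num
      simp only [f, hlog]
      linarith
    exact hend.trans (hmono ⟨le_rfl, by norm_num⟩ ⟨hx, h1⟩ hx)

/-- A power with exponent `b / a ≤ 1` exceeds its base by at most `log (a / b)`. -/
theorem rpow_div_le_add_log_div {u a b : ℝ} (hu : 0 ≤ u) (hb : 0 < b) (hba : b ≤ a) :
    u ^ (b / a) ≤ u + Real.log (a / b) := by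
  have ha : 0 < a := hb.trans_le hba
  have h1 : b / a ≤ 1 := (div_le_one ha).2 hba
  have h0 : 0 ≤ b / a := by positivity
  have hbern := rpow_one_add_le_one_add_mul_self (s := u - 1) (by linarith) h0 h1
  rw [add_sub_cancel] at hbern
  have hlog := Real.one_sub_inv_le_log_of_pos (x := a / b) (by positivity)
  rw [inv_div] at hlog
  nlinarith [mul_le_mul_of_nonneg_right h1 hu]

/-- With weights proportional to `η w exp (η m)`, a second-order optimistic exponential update
does not increase the total potential. -/
theorem sum_mul_exp_optimistic_le {ι : Type*} [Fintype ι] {w η m p ℓ r : ι → ℝ}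
    (hw : ∀ i, 0 < w i) (hη : ∀ i, 0 < η i) (hm : ∀ i, -1 < m i)
    (hηm : ∀ i, η i ≤ 2 / (3 * (1 + m i))) (hℓ : ∀ i, 0 ≤ ℓ i ∧ ℓ i ≤ 1)
    (hp : ∀ i, p i = η i * w i * Real.exp (η i * m i) / ∑ j, η j * w j * Real.exp (η j * m j))
    (hr : ∀ i, r i = ∑ j, p j * ℓ j - ℓ i) :
    ∑ i, w i * Real.exp (η i * r i - η i ^ 2 * (r i - m i) ^ 2) ≤ ∑ i, w i := by
  rcases isEmpty_or_nonempty ι with _ | _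
  · simp
  set v : ι → ℝ := fun i => η i * w i * Real.exp (η i * m i) with hv
  have hvpos : ∀ i, 0 < v i := fun i => by have := hw i; have := hη i; positivity
  have hS : 0 < ∑ j, v j := Finset.sum_pos (fun i _ => hvpos i) Finset.univ_nonempty
  have hp0 : ∀ i, 0 ≤ p i := fun i => by
    rw [hp]
    exact (div_pos (hvpos i) hS).le
  have hmean : (∑ j, v j) * ∑ j, p j * ℓ j = ∑ j, v j * ℓ j := by
    rw [Finset.mul_sum]
    refine Finset.sum_congr rfl fun j _ => ?_
    rw [hp j, ← mul_assoc, mul_div_cancel₀ _ hS.ne']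
  have hcancel : ∑ i, v i * r i = 0 := by
    simp only [hr, mul_sub, Finset.sum_sub_distrib, ← Finset.sum_mul]
    rw [hmean, sub_self]
  have hrge : ∀ i, -1 ≤ r i := fun i => by
    have : 0 ≤ ∑ j, p j * ℓ j := Finset.sum_nonneg fun j _ => mul_nonneg (hp0 j) (hℓ j).1
    rw [hr]
    linarith [(hℓ i).2]
  have hterm : ∀ i, w i * Real.exp (η i * r i - η i ^ 2 * (r i - m i) ^ 2) ≤
      w i + v i * r i := by
    intro i
    have hm' : 0 < 1 + m i := by linarith [hm i]
    have hηm' : η i * (1 + m i) ≤ 2 / 3 := by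
      have := hηm i
      rw [le_div_iff₀ (by positivity)] at this
      linarith
    have hx : -(2 / 3) ≤ η i * (r i - m i) := by
      nlinarith [mul_le_mul_of_nonneg_left (hrge i) (hη i).le]
    have hexp : Real.exp (η i * (r i - m i) - (η i * (r i - m i)) ^ 2) ≤
        1 + η i * (r i - m i) :=
      (Real.le_log_iff_exp_le (by linarith)).1 (sub_sq_le_log_one_add hx)
    have hone : Real.exp (η i * m i) * (1 - η i * m i) ≤ 1 := by
      have h := mul_le_mul_of_nonneg_left (Real.one_sub_le_exp_neg (η i * m i))
        (Real.exp_pos (η i * m i)).le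
      rwa [← Real.exp_add, add_neg_cancel, Real.exp_zero] at h
    calc w i * Real.exp (η i * r i - η i ^ 2 * (r i - m i) ^ 2)
        = w i * (Real.exp (η i * m i) *
            Real.exp (η i * (r i - m i) - (η i * (r i - m i)) ^ 2)) := by
          rw [← Real.exp_add]
          ring_nf
      _ ≤ w i * (Real.exp (η i * m i) * (1 + η i * (r i - m i))) := by
          have := (hw i).le
          gcongr
      _ = w i * (Real.exp (η i * m i) * (1 - η i * m i)) + v i * r i := by
          simp only [hv]
          ring
      _ ≤ w i + v i * r i := by
          linarith [mul_le_mul_of_nonneg_left hone (hw i).le]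
  calc ∑ i, w i * Real.exp (η i * r i - η i ^ 2 * (r i - m i) ^ 2)
      ≤ ∑ i, (w i + v i * r i) := Finset.sum_le_sum fun i _ => hterm i
    _ = ∑ i, w i := by rw [Finset.sum_add_distrib, hcancel, add_zero]


theorem adaprod_total_potential_bound
    (K T : ℕ) (hK : 2 ≤ K) (hT : 1 ≤ T)
    (ℓ rhat : ℕ → Fin K → ℝ)
    (hℓ : ∀ t, 1 ≤ t → t ≤ T → ∀ i, 0 ≤ ℓ t i ∧ ℓ t i ≤ 1)
    (hrhat1 : ∀ i, rhat 1 i = 0)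
    (hrhatT : ∀ i, rhat (T + 1) i = 0)
    (hrhatmem : ∀ t, 1 ≤ t → t ≤ T + 1 → ∀ i, -1 < rhat t i ∧ rhat t i ≤ 1)
    (w p r C η : ℕ → Fin K → ℝ)
    (hw0 : ∀ i, w 0 i = 1)
    (hη0 : ∀ i, η 0 i = Real.sqrt (Real.log K / 2))
    (hC0 : ∀ i, C 0 i = 0)
    (hp : ∀ t, 1 ≤ t → t ≤ T → ∀ i,
      p t i = η (t - 1) i * w (t - 1) i * Real.exp (η (t - 1) i * rhat t i) /
        ∑ j, η (t - 1) j * w (t - 1) j * Real.exp (η (t - 1) j * rhat t j))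
    (hr : ∀ t, 1 ≤ t → t ≤ T → ∀ i,
      r t i = (∑ j, p t j * ℓ t j) - ℓ t i)
    (hC : ∀ t, 1 ≤ t → t ≤ T → ∀ i,
      C t i = C (t - 1) i + (rhat t i - r t i) ^ 2)
    (hη : ∀ t, 1 ≤ t → t ≤ T → ∀ i,
      η t i = min (η (t - 1) i)
        (min (2 / (3 * (1 + rhat (t + 1) i))) (Real.sqrt (Real.log K / C t i))))
    (hwt : ∀ t, 1 ≤ t → t ≤ T → ∀ i,
      w t i = (w (t - 1) i *
        Real.exp (η (t - 1) i * r t i - (η (t - 1) i) ^ 2 * (r t i - rhat t i) ^ 2)) ^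
          (η t i / η (t - 1) i))
    (hCpos : ∀ t, 1 ≤ t → t ≤ T → ∀ i, 0 < C t i) :
    ∑ i, w T i ≤ K * Real.exp (1/4) + ∑ i, Real.log (η 0 i / η T i) := by
  have hlogK : 0 < Real.log K := Real.log_pos (by exact_mod_cast hK)
  have hη_pos : ∀ t ≤ T, ∀ i, 0 < η t i := by
    intro t
    induction t with
    | zero =>
      intro _ i
      rw [hη0]
      positivity
    | succ n ih =>
      intro hn i
      rw [hη (n + 1) (by omega) hn i]
      have h1 := hCpos (n + 1) (by omega) hn i
      have h2 : 0 < 1 + rhat (n + 1 + 1) i := by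
        linarith [(hrhatmem (n + 1 + 1) (by omega) (by omega) i).1]
      exact lt_min (ih (by omega) i) (lt_min (by positivity) (by positivity))
  have hη_anti : ∀ n, n + 1 ≤ T → ∀ i, η (n + 1) i ≤ η n i := fun n hn i => by
    rw [hη (n + 1) (by omega) hn i]
    exact min_le_left _ _
  have hw_pos : ∀ t ≤ T, ∀ i, 0 < w t i := by
    intro t
    induction t with
    | zero => simp [hw0]
    | succ n ih =>
      intro hn i
      rw [hwt (n + 1) (by omega) hn i]
      exact Real.rpow_pos_of_pos (mul_pos (ih (by omega) i) (Real.exp_pos _)) _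
  suffices h : ∀ t, 1 ≤ t → t ≤ T →
      ∑ i, w t i ≤ K * Real.exp (1 / 4) + ∑ i, Real.log (η 0 i / η t i) from h T hT le_rfl
  intro t ht
  induction t, ht using Nat.le_induction with
  | base =>
    intro _
    have hfirst : ∀ i, w 1 i ≤ Real.exp (1 / 4) + Real.log (η 0 i / η 1 i) := by
      intro i
      have h0 := hη_pos 0 (by omega) i
      have h1 := hη_pos 1 hT i
      have hle : η 1 i ≤ η 0 i := hη_anti 0 hT i
      have hexp : w 0 i * Real.exp (η 0 i * r 1 i - η 0 i ^ 2 * (r 1 i - rhat 1 i) ^ 2) ≤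
          Real.exp (1 / 4) := by
        rw [hw0, hrhat1, one_mul]
        exact Real.exp_le_exp.2 (by nlinarith [sq_nonneg (η 0 i * r 1 i - 1 / 2)])
      have hpow := rpow_div_le_add_log_div
        (mul_pos (hw_pos 0 (by omega) i) (Real.exp_pos
          (η 0 i * r 1 i - η 0 i ^ 2 * (r 1 i - rhat 1 i) ^ 2))).le h1 hle
      rw [hwt 1 le_rfl hT i]
      exact hpow.trans (by linarith)
    calc ∑ i, w 1 i ≤ ∑ i, (Real.exp (1 / 4) + Real.log (η 0 i / η 1 i)) :=
          Finset.sum_le_sum fun i _ => hfirst i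
      _ = K * Real.exp (1 / 4) + ∑ i, Real.log (η 0 i / η 1 i) := by
          simp [Finset.sum_add_distrib]
  | succ n hn ih =>
    intro hnT
    have hstep := sum_mul_exp_optimistic_le (hw_pos n (by omega)) (hη_pos n (by omega))
      (fun i => (hrhatmem (n + 1) (by omega) (by omega) i).1)
      (fun i => by
        rw [hη n hn (by omega) i]
        exact (min_le_right _ _).trans (min_le_left _ _))
      (hℓ (n + 1) (by omega) hnT) (hp (n + 1) (by omega) hnT) (hr (n + 1) (by omega) hnT)
    have hpow : ∀ i, w (n + 1) i ≤
        w n i * Real.exp (η n i * r (n + 1) i - η n i ^ 2 * (r (n + 1) i - rhat (n + 1) i) ^ 2)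
          + Real.log (η n i / η (n + 1) i) := fun i => by
      rw [hwt (n + 1) (by omega) hnT i]
      exact rpow_div_le_add_log_div
        (mul_pos (hw_pos n (by omega) i) (Real.exp_pos _)).le (hη_pos (n + 1) hnT i)
        (hη_anti n hnT i)
    have hsum := Finset.sum_le_sum fun i (_ : i ∈ Finset.univ) => hpow i
    rw [Finset.sum_add_distrib] at hsum
    have htel : ∑ i, Real.log (η 0 i / η (n + 1) i) =
        ∑ i, Real.log (η 0 i / η n i) + ∑ i, Real.log (η n i / η (n + 1) i) := by
      rw [← Finset.sum_add_distrib]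
      refine Finset.sum_congr rfl fun i _ => ?_
      have h0 := (hη_pos 0 (by omega) i).ne'
      have h1 := (hη_pos n (by omega) i).ne'
      have h2 := (hη_pos (n + 1) hnT i).ne'
      rw [Real.log_div h0 h2, Real.log_div h0 h1, Real.log_div h1 h2]
      ring
    linarith [ih (by omega)]
end

section
/- Under the base AdaProd⁺ recursion, for every expert i ∈ {1,…,K}: Σ_{t=1}^{T} r_{t,i} ≤ (1/η_{T,i}) · log( Σ_{j=1}^{K} w_{T,j} ) + Σ_{t=1}^{T} η_{t−1,i}·( r_{t,i} − ŕ_{t,i} )². -/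
theorem weight_pos_and_log_weight_eq {T : ℕ} {η w a : ℕ → ℝ} (hw0 : w 0 = 1)
    (hη : ∀ t ≤ T, 0 < η t)
    (hw : ∀ t < T, w (t + 1) = (w t * Real.exp (η t * a (t + 1))) ^ (η (t + 1) / η t)) :
    ∀ t ≤ T, 0 < w t ∧ Real.log (w t) = η t * ∑ s ∈ Finset.Icc 1 t, a s := by
  intro t
  induction t with
  | zero => simp [hw0]
  | succ t ih =>
    intro ht
    obtain ⟨hpos, hlog⟩ := ih (by omega)
    have hηt := (hη t (by omega)).ne'
    have hmul : 0 < w t * Real.exp (η t * a (t + 1)) := mul_pos hpos (Real.exp_pos _)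
    rw [hw t ht]
    refine ⟨Real.rpow_pos_of_pos hmul _, ?_⟩
    rw [Real.log_rpow hmul, Real.log_mul hpos.ne' (Real.exp_ne_zero _), Real.log_exp, hlog,
      Finset.sum_Icc_succ_top (by omega)]
    field_simp


theorem adaprod_regret_decomposition
    (K T : ℕ) (hK : 2 ≤ K) (hT : 1 ≤ T)
    (ℓ rhat : ℕ → Fin K → ℝ)
    (hℓ : ∀ t, 1 ≤ t → t ≤ T → ∀ i, 0 ≤ ℓ t i ∧ ℓ t i ≤ 1)
    (hrhat1 : ∀ i, rhat 1 i = 0)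
    (hrhatT : ∀ i, rhat (T + 1) i = 0)
    (hrhatmem : ∀ t, 1 ≤ t → t ≤ T + 1 → ∀ i, -1 < rhat t i ∧ rhat t i ≤ 1)
    (w p r C η : ℕ → Fin K → ℝ)
    (hw0 : ∀ i, w 0 i = 1)
    (hη0 : ∀ i, η 0 i = Real.sqrt (Real.log K / 2))
    (hC0 : ∀ i, C 0 i = 0)
    (hp : ∀ t, 1 ≤ t → t ≤ T → ∀ i,
      p t i = η (t - 1) i * w (t - 1) i * Real.exp (η (t - 1) i * rhat t i) /
        ∑ j, η (t - 1) j * w (t - 1) j * Real.exp (η (t - 1) j * rhat t j))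
    (hr : ∀ t, 1 ≤ t → t ≤ T → ∀ i,
      r t i = (∑ j, p t j * ℓ t j) - ℓ t i)
    (hC : ∀ t, 1 ≤ t → t ≤ T → ∀ i,
      C t i = C (t - 1) i + (rhat t i - r t i) ^ 2)
    (hη : ∀ t, 1 ≤ t → t ≤ T → ∀ i,
      η t i = min (η (t - 1) i)
        (min (2 / (3 * (1 + rhat (t + 1) i))) (Real.sqrt (Real.log K / C t i))))
    (hwt : ∀ t, 1 ≤ t → t ≤ T → ∀ i,
      w t i = (w (t - 1) i *
        Real.exp (η (t - 1) i * r t i - (η (t - 1) i) ^ 2 * (r t i - rhat t i) ^ 2)) ^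
          (η t i / η (t - 1) i))
    (hCpos : ∀ t, 1 ≤ t → t ≤ T → ∀ i, 0 < C t i) :
    ∀ i, ∑ t ∈ Finset.Icc 1 T, r t i ≤
      (1 / η T i) * Real.log (∑ j, w T j) +
        ∑ t ∈ Finset.Icc 1 T, η (t - 1) i * (r t i - rhat t i) ^ 2 := by
  intro i
  have hlogK : 0 < Real.log K := Real.log_pos (by exact_mod_cast hK)
  have hηpos : ∀ j, ∀ t ≤ T, 0 < η t j := by
    intro j t
    induction t with
    | zero =>
      intro _
      rw [hη0]
      positivity
    | succ t ih =>
      intro ht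
      rw [hη (t + 1) (by omega) ht j]
      have hden : 0 < 1 + rhat (t + 1 + 1) j := by
        linarith [(hrhatmem (t + 1 + 1) (by omega) (by omega) j).1]
      have hCt := hCpos (t + 1) (by omega) ht j
      exact lt_min (ih (by omega)) (lt_min (by positivity) (by positivity))
  have hlogw : ∀ j, 0 < w T j ∧ Real.log (w T j) = η T j *
      ∑ t ∈ Finset.Icc 1 T, (r t j - η (t - 1) j * (r t j - rhat t j) ^ 2) := by
    intro j
    refine weight_pos_and_log_weight_eq (η := fun t => η t j) (w := fun t => w t j)
      (a := fun t => r t j - η (t - 1) j * (r t j - rhat t j) ^ 2)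
      (hw0 j) (hηpos j) ?_ T le_rfl
    intro t ht
    simp only [hwt (t + 1) (by omega) ht j, Nat.add_sub_cancel]
    ring_nf
  obtain ⟨hwpos, hlog⟩ := hlogw i
  have hle : Real.log (w T i) ≤ Real.log (∑ j, w T j) :=
    Real.log_le_log hwpos
      (Finset.single_le_sum (fun j _ => (hlogw j).1.le) (Finset.mem_univ i))
  rw [← sub_le_iff_le_add, ← Finset.sum_sub_distrib, one_div_mul_eq_div,
    le_div_iff₀ (hηpos i T le_rfl), mul_comm, ← hlog]
  exact hle
end

section
/- For every integer T ≥ 1 and all reals a_1,…,a_T with 0 ≤ a_t ≤ 1 for each t: Σ_{t=1}^{T} a_t / √( 1 + Σ_{s=1}^{t−1} a_s ) ≤ 2 · √( Σ_{t=1}^{T} a_t ). -/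
theorem div_sqrt_one_add_le_two_mul_sub_sqrt {S x : ℝ} (hS : 0 ≤ S) (hx0 : 0 ≤ x) (hx1 : x ≤ 1) :
    x / Real.sqrt (1 + S) ≤ 2 * (Real.sqrt (S + x) - Real.sqrt S) := by
  have hpos : 0 < Real.sqrt (1 + S) := Real.sqrt_pos.mpr (by linarith)
  have hle : Real.sqrt (S + x) ≤ Real.sqrt (1 + S) := Real.sqrt_le_sqrt (by linarith)
  have hmono : Real.sqrt S ≤ Real.sqrt (S + x) := Real.sqrt_le_sqrt (by linarith)
  have hsq : Real.sqrt S ^ 2 = S := Real.sq_sqrt hS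
  have hsq' : Real.sqrt (S + x) ^ 2 = S + x := Real.sq_sqrt (by linarith)
  rw [div_le_iff₀ hpos]
  calc x = (Real.sqrt (S + x) - Real.sqrt S) * (Real.sqrt (S + x) + Real.sqrt S) := by
        linear_combination hsq - hsq'
    _ ≤ (Real.sqrt (S + x) - Real.sqrt S) * (2 * Real.sqrt (1 + S)) :=
        mul_le_mul_of_nonneg_left (by linarith) (sub_nonneg.mpr hmono)
    _ = 2 * (Real.sqrt (S + x) - Real.sqrt S) * Real.sqrt (1 + S) := by ring

theorem self_normalized_sum_bound
    (T : ℕ) (hT : 1 ≤ T)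
    (a : ℕ → ℝ) (ha : ∀ t, 1 ≤ t → t ≤ T → 0 ≤ a t ∧ a t ≤ 1) :
    ∑ t ∈ Finset.Icc 1 T, a t / Real.sqrt (1 + ∑ s ∈ Finset.Icc 1 (t - 1), a s) ≤
      2 * Real.sqrt (∑ t ∈ Finset.Icc 1 T, a t) := by
  clear hT
  induction T with
  | zero => simp
  | succ n ih =>
    have hn := ih fun t h1 h2 => ha t h1 (by omega)
    have hS : 0 ≤ ∑ s ∈ Finset.Icc 1 n, a s := Finset.sum_nonneg fun t ht => by
      rw [Finset.mem_Icc] at ht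
      exact (ha t ht.1 (by omega)).1
    obtain ⟨h0, h1⟩ := ha (n + 1) (by omega) le_rfl
    have hstep := div_sqrt_one_add_le_two_mul_sub_sqrt hS h0 h1
    rw [Finset.sum_Icc_succ_top (by omega), Finset.sum_Icc_succ_top (by omega),
      Nat.add_sub_cancel]
    linarith
end
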